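/- arXiv:2605.04258 — 2 statements merged into one kernel-verified Lean document; each statement's English description precedes it below -/
import Mathlib

section
/- Let i be an index with 1 < i ≤ n and let c := BWT[i]. Set ℓ* := i if w(i) = LCP[i] and ℓ* := i+1 otherwise, and curr_b := b(ℓ*). If i = Candt_c(curr_b, i+1), then at least one of the following conditions holds: (C1) w(i) > LCP[i]; (C2) w(i) > -1 and pIdx(c, i) < curr_b; (C3) pW(c, i) < w(i). -/
open scoped Classical

/-- `seg T i len` is the string `T[i..i+len-1]`. -/
def seg (T : ℕ → ℤ) (i len : ℕ) : List ℤ :=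
  (List.range len).map fun k => T (i + k)

/-- `sfx T n p` is the suffix `T[p..n]` of a length-`n` text. -/
def sfx (T : ℕ → ℤ) (n p : ℕ) : List ℤ := seg T p (n + 1 - p)

/-- The reversed text: `Trev T n n = T n` and `Trev T n i = T (n - i)` for `i < n`. -/
def Trev (T : ℕ → ℤ) (n : ℕ) : ℕ → ℤ := fun i => if i = n then T n else T (n - i)

/-- Length of the longest common prefix of two strings. -/
def lcpLen : List ℤ → List ℤ → ℕ
  | a :: l₁, b :: l₂ => if a = b then lcpLen l₁ l₂ + 1 else 0
  | _, _ => 0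

/-- `s` occurs as a substring of `T[1..n]`. -/
def OccursIn (T : ℕ → ℤ) (n : ℕ) (s : List ℤ) : Prop :=
  ∃ i : ℕ, 1 ≤ i ∧ i + s.length ≤ n + 1 ∧ s = seg T i s.length

/-- `s` is a right-maximal substring of `T[1..n]` over the alphabet `{1,…,σ}`. -/
def RightMax (T : ℕ → ℤ) (n σ : ℕ) (s : List ℤ) : Prop :=
  ∃ a b : ℤ, a ≠ b ∧ 1 ≤ a ∧ a ≤ (σ : ℤ) ∧ 1 ≤ b ∧ b ≤ (σ : ℤ) ∧
    OccursIn T n (s ++ [a]) ∧ OccursIn T n (s ++ [b])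

/-- `X` is a suffixient set for `T[1..n]`. -/
def Suffixient (T : ℕ → ℤ) (n σ : ℕ) (X : Set ℕ) : Prop :=
  ∀ s : List ℤ, RightMax T n σ s → ∀ c : ℤ, 1 ≤ c → c ≤ (σ : ℤ) →
    OccursIn T n (s ++ [c]) → ∃ x ∈ X, (s ++ [c]) <:+ seg T 1 x

def StartRun (BWT : ℕ → ℤ) (x : ℕ) : Prop := 1 < x ∧ BWT x ≠ BWT (x - 1)

def EndRun (BWT : ℕ → ℤ) (n x : ℕ) : Prop := x < n ∧ BWT x ≠ BWT (x + 1)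

def RunBoundary (BWT : ℕ → ℤ) (n x : ℕ) : Prop := StartRun BWT x ∨ EndRun BWT n x

/-- `bIdx L x` : the largest index `y < x` with `L y < L x`, or `1` if none exists. -/
noncomputable def bIdx (L : ℕ → ℤ) (x : ℕ) : ℕ :=
  sSup {y : ℕ | (1 ≤ y ∧ y < x ∧ L y < L x) ∨ y = 1}

/-- `eIdx L n x` : the smallest index `y > x` with `L y < L x`, or `n+1` if none exists. -/
noncomputable def eIdx (L : ℕ → ℤ) (n x : ℕ) : ℕ :=
  sInf {y : ℕ | (x < y ∧ y ≤ n ∧ L y < L x) ∨ y = n + 1}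

/-- The maximal weight `w y` over indices `a ≤ y < a'` with `BWT y = c` and `w y ≥ 0`. -/
noncomputable def wMax (BWT w : ℕ → ℤ) (c : ℤ) (a a' : ℕ) : ℤ :=
  (sSup {m : ℕ | ∃ q : ℕ, a ≤ q ∧ q < a' ∧ BWT q = c ∧ 0 ≤ w q ∧ (m : ℤ) = w q} : ℕ)

/-- `Candt BWT w c a a'`: the smallest index `a ≤ p < a'` with `BWT p = c` whose weight
attains the maximum weight among such indices; `-1` if no index
`a ≤ y < a'` with `BWT y = c` and `w y ≥ 0` exists. -/
noncomputable def Candt (BWT w : ℕ → ℤ) (c : ℤ) (a a' : ℕ) : ℤ :=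
  if ∃ p : ℕ, a ≤ p ∧ p < a' ∧ BWT p = c ∧ 0 ≤ w p then
    ((sInf {p : ℕ | a ≤ p ∧ p < a' ∧ BWT p = c ∧ w p = wMax BWT w c a a'} : ℕ) : ℤ)
  else -1

def FullL (n : ℕ) (SA : ℕ → ℕ) (BWT LCP w : ℕ → ℤ) : Set ℕ :=
  { q | ∃ x : ℕ, 1 < x ∧ x ≤ n ∧ BWT x ≠ BWT (x - 1) ∧
      ∃ c : ℤ, (c = BWT x ∨ c = BWT (x - 1)) ∧
      ∃ p : ℕ, (p : ℤ) = Candt BWT w c (bIdx LCP x) (eIdx LCP n x) ∧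
        q = n - SA p + 1 }

/-- Basic assumptions on the text `T[1..n]` over alphabet `{1,…,σ}` with sentinel `dollar`. -/
structure TextSetup (n σ : ℕ) (T : ℕ → ℤ) (dollar : ℤ) : Prop where
  hn : 2 ≤ n
  hsigma : 2 ≤ σ
  hsigma_le : σ ≤ n
  hT : ∀ i, 1 ≤ i → i ≤ n → 1 ≤ T i ∧ T i ≤ (σ : ℤ)
  hTn : T n = dollar
  hTne : ∀ i, 1 ≤ i → i < n → T i ≠ dollar

/-- `SA[1..n]` is the suffix array of the reversed text. -/
structure SASetup (n σ : ℕ) (T : ℕ → ℤ) (dollar : ℤ) (SA : ℕ → ℕ)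
    extends TextSetup n σ T dollar : Prop where
  hSAmem : ∀ i, 1 ≤ i → i ≤ n → 1 ≤ SA i ∧ SA i ≤ n
  hSAinj : ∀ i j, 1 ≤ i → i ≤ n → 1 ≤ j → j ≤ n → SA i = SA j → i = j
  hSAsurj : ∀ p, 1 ≤ p → p ≤ n → ∃ i, 1 ≤ i ∧ i ≤ n ∧ SA i = p
  hSAord : ∀ i j, 1 ≤ i → i < j → j ≤ n →
    List.Lex (· < ·) (sfx (Trev T n) n (SA i)) (sfx (Trev T n) n (SA j))

/-- `LCP[1..n]` is the LCP array of the reversed text. -/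
structure LCPSetup (n σ : ℕ) (T : ℕ → ℤ) (dollar : ℤ) (SA : ℕ → ℕ) (LCP : ℕ → ℤ)
    extends SASetup n σ T dollar SA : Prop where
  hLCP1 : LCP 1 = -1
  hLCP : ∀ i, 1 < i → i ≤ n →
    LCP i = (lcpLen (sfx (Trev T n) n (SA (i - 1))) (sfx (Trev T n) n (SA i)) : ℤ)
  hLCPend : LCP (n + 1) = -1

/-- Additionally, `BWT[1..n]` is the BWT of the reversed text and `w` is the weight function. -/
structure FullSetup (n σ : ℕ) (T : ℕ → ℤ) (dollar : ℤ) (SA : ℕ → ℕ)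
    (BWT LCP w : ℕ → ℤ) extends LCPSetup n σ T dollar SA LCP : Prop where
  hBWT : ∀ i, 1 ≤ i → i ≤ n → BWT i = T (n - SA i + 1)
  hBWTend : BWT (n + 1) = -1
  hwNot : ∀ x, 1 ≤ x → x ≤ n → ¬ RunBoundary BWT n x → w x = -1
  hwRB : ∀ x, 1 ≤ x → x ≤ n → RunBoundary BWT n x →
    (∃ s : List ℤ, RightMax T n σ s ∧ s <:+ seg T 1 (n - SA x)) →
    IsGreatest {m : ℤ | ∃ s : List ℤ, RightMax T n σ s ∧ s <:+ seg T 1 (n - SA x) ∧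
      m = (s.length : ℤ)} (w x)

/-- `sIdx`: the minimum index `i ∈ [1..n]` such that `T[n-SA[ℓ]+1-w(ℓ)..n-SA[ℓ]]`
is a suffix of `T[1..n-SA[i]]`. -/
noncomputable def sIdx (T : ℕ → ℤ) (n : ℕ) (SA : ℕ → ℕ) (w : ℕ → ℤ) (l : ℕ) : ℕ :=
  sInf {i : ℕ | 1 ≤ i ∧ i ≤ n ∧
    seg T (n - SA l + 1 - (w l).toNat) (w l).toNat <:+ seg T 1 (n - SA i)}

/-- `tIdx`: the maximum such index. -/
noncomputable def tIdx (T : ℕ → ℤ) (n : ℕ) (SA : ℕ → ℕ) (w : ℕ → ℤ) (l : ℕ) : ℕ :=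
  sSup {i : ℕ | 1 ≤ i ∧ i ≤ n ∧
    seg T (n - SA l + 1 - (w l).toNat) (w l).toNat <:+ seg T 1 (n - SA i)}

/-- `pIdx c i`: the largest index `j < i` with `w j > -1` and `BWT j = c`, or `0`. -/
noncomputable def pIdx (BWT w : ℕ → ℤ) (c : ℤ) (i : ℕ) : ℕ :=
  sSup {j : ℕ | (1 ≤ j ∧ j < i ∧ -1 < w j ∧ BWT j = c) ∨ j = 0}

/-- `pW c i`: the weight of `pIdx c i`, or `-1` if no index as in `pIdx` exists. -/
noncomputable def pW (BWT w : ℕ → ℤ) (c : ℤ) (i : ℕ) : ℤ :=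
  if ∃ j : ℕ, 1 ≤ j ∧ j < i ∧ -1 < w j ∧ BWT j = c then w (pIdx BWT w c i) else -1

/-- `α` is colexicographically smaller than `β`. -/
def ColexLt (α β : List ℤ) : Prop :=
  (α ≠ β ∧ α <:+ β) ∨
  ∃ k : ℕ, 1 ≤ k ∧ k ≤ α.length ∧ k ≤ β.length ∧
    (∀ i, 1 ≤ i → i < k → α.getD (α.length - i) 0 = β.getD (β.length - i) 0) ∧
    α.getD (α.length - k) 0 < β.getD (β.length - k) 0

theorem one_le_bIdx (L : ℕ → ℤ) (x : ℕ) : 1 ≤ bIdx L x :=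
  le_csSup ⟨max x 1, by rintro y (⟨-, h, -⟩ | h) <;> omega⟩ (Or.inr rfl)

theorem pIdx_spec (BWT w : ℕ → ℤ) (c : ℤ) (i : ℕ) :
    (1 ≤ pIdx BWT w c i ∧ pIdx BWT w c i < i ∧ -1 < w (pIdx BWT w c i) ∧
      BWT (pIdx BWT w c i) = c) ∨ pIdx BWT w c i = 0 :=
  Nat.sSup_mem
    (s := {j : ℕ | (1 ≤ j ∧ j < i ∧ -1 < w j ∧ BWT j = c) ∨ j = 0})
    ⟨0, Or.inr rfl⟩ ⟨i, by rintro y (⟨-, h, -⟩ | h) <;> omega⟩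

theorem wMax_nonneg (BWT w : ℕ → ℤ) (c : ℤ) (a a' : ℕ) : 0 ≤ wMax BWT w c a a' :=
  Int.natCast_nonneg _

theorem le_wMax {BWT w : ℕ → ℤ} {c : ℤ} {a a' q : ℕ} (haq : a ≤ q) (hqa' : q < a')
    (hc : BWT q = c) (hq : 0 ≤ w q) : w q ≤ wMax BWT w c a a' := by
  have hbdd : BddAbove
      {m : ℕ | ∃ q : ℕ, a ≤ q ∧ q < a' ∧ BWT q = c ∧ 0 ≤ w q ∧ (m : ℤ) = w q} := by
    refine (((Set.finite_Iio a').image fun q => (w q).toNat).subset ?_).bddAbove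
    rintro m ⟨q, -, hq, -, -, hm⟩
    exact ⟨q, hq, by simp [← hm]⟩
  have hle := le_csSup hbdd (a := (w q).toNat)
    ⟨q, haq, hqa', hc, hq, Int.toNat_of_nonneg hq⟩
  unfold wMax
  omega

theorem eq_Candt_spec {BWT w : ℕ → ℤ} {c : ℤ} {a a' i : ℕ} (hi : 0 < i)
    (h : (i : ℤ) = Candt BWT w c a a') :
    w i = wMax BWT w c a a' ∧
      ∀ p, a ≤ p → p < a' → BWT p = c → w p = wMax BWT w c a a' → i ≤ p := by
  unfold Candt at h
  split_ifs at h
  have h' := Int.ofNat_inj.mp h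
  have hmem := Nat.sInf_mem (Nat.nonempty_of_pos_sInf (h' ▸ hi))
  rw [← h'] at hmem
  refine ⟨hmem.2.2.2, fun p h₁ h₂ h₃ h₄ => ?_⟩
  rw [h']
  exact Nat.sInf_le ⟨h₁, h₂, h₃, h₄⟩

/-- Let `1 < i ≤ n`, `c := BWT[i]`, `ℓ* := i` if `w(i) = LCP[i]` and `ℓ* := i+1`
otherwise, `curr_b := b(ℓ*)`. If `i = Candt_c(curr_b, i+1)`, then (C1) `w(i) > LCP[i]`, or
(C2) `w(i) > -1` and `pIdx(c, i) < curr_b`, or (C3) `pW(c, i) < w(i)`. -/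
theorem stmt13 (n σ : ℕ) (T : ℕ → ℤ) (dollar : ℤ) (SA : ℕ → ℕ) (BWT LCP w : ℕ → ℤ)
    (hsetup : FullSetup n σ T dollar SA BWT LCP w)
    (i : ℕ) (hi1 : 1 < i) (hin : i ≤ n)
    (lstar : ℕ) (hlstar : lstar = if w i = LCP i then i else i + 1)
    (currb : ℕ) (hcurrb : currb = bIdx LCP lstar)
    (hcand : (i : ℤ) = Candt BWT w (BWT i) currb (i + 1)) :
    LCP i < w i ∨
      (-1 < w i ∧ pIdx BWT w (BWT i) i < currb) ∨
      pW BWT w (BWT i) i < w i := by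
  obtain ⟨hwi, hmin⟩ := eq_Candt_spec (by omega) hcand
  have hwi0 := wMax_nonneg BWT w (BWT i) currb (i + 1)
  by_cases hp : pIdx BWT w (BWT i) i < currb
  · exact Or.inr (Or.inl ⟨by omega, hp⟩)
  have hb : 1 ≤ currb := hcurrb ▸ one_le_bIdx LCP lstar
  rcases pIdx_spec BWT w (BWT i) i with hspec | hzero
  · have ⟨_, hlt, hw, hc⟩ := hspec
    refine Or.inr (Or.inr ?_)
    rw [pW, if_pos ⟨_, hspec⟩]
    have hle := le_wMax (w := w) (not_lt.mp hp) (by omega : _ < i + 1) hc (by omega)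
    rw [← hwi] at hle hmin
    refine lt_of_le_of_ne hle fun heq => ?_
    have := hmin _ (not_lt.mp hp) (by omega) hc heq
    omega
  · omega
end

section
/- For every index i with 2 ≤ i ≤ n, consider the chain i = x_0 > x_1 > … > x_m = 1 defined by x_{k+1} := b(x_k) for k ≥ 0, terminating at the first index equal to 1. Let h be the maximum, over all suffixes S of T^rev, of the number of distinct right-maximal substrings of T^rev that occur as prefixes of S. Then the chain contains at most h + 1 indices, i.e., m ≤ h. -/
open scoped Classical

theorem seg_succ (T : ℕ → ℤ) (i len : ℕ) : seg T i (len + 1) = T i :: seg T (i + 1) len := by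
  simp [seg, List.range_succ_eq_map, Function.comp_def, Nat.add_assoc, Nat.add_comm 1]

theorem seg_succ_last (T : ℕ → ℤ) (i len : ℕ) : seg T i (len + 1) = seg T i len ++ [T (i + len)] := by
  simp [seg, List.range_succ]

@[simp] theorem length_seg (T : ℕ → ℤ) (i len : ℕ) : (seg T i len).length = len := by
  simp [seg]

theorem seg_congr {T : ℕ → ℤ} {p q t : ℕ} (h : ∀ k < t, T (p + k) = T (q + k)) :
    seg T p t = seg T q t := by
  simpa [seg] using h

theorem seg_prefix_seg (T : ℕ → ℤ) (p : ℕ) {a b : ℕ} (h : a ≤ b) : seg T p a <+: seg T p b := by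
  induction b, h using Nat.le_induction with
  | base => exact List.prefix_rfl
  | succ b _ ih => exact ih.trans (seg_succ_last T p b ▸ List.prefix_append _ _)

theorem lcpLen_seg (T : ℕ → ℤ) (p q a b : ℕ) :
    lcpLen (seg T p a) (seg T q b) ≤ a ∧ lcpLen (seg T p a) (seg T q b) ≤ b ∧
    (∀ k < lcpLen (seg T p a) (seg T q b), T (p + k) = T (q + k)) ∧
    (lcpLen (seg T p a) (seg T q b) < a → lcpLen (seg T p a) (seg T q b) < b →
      T (p + lcpLen (seg T p a) (seg T q b)) ≠ T (q + lcpLen (seg T p a) (seg T q b))) := by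
  induction a generalizing p q b with
  | zero => simp [seg, lcpLen]
  | succ a ih =>
    cases b with
    | zero => simp [seg, lcpLen]
    | succ b =>
      rw [seg_succ, seg_succ, lcpLen]
      split_ifs with hpq
      · obtain ⟨h1, h2, h3, h4⟩ := ih (p + 1) (q + 1) b
        refine ⟨by omega, by omega, ?_, ?_⟩
        · rintro (_ | k) hk
          · exact hpq
          · have := h3 k (by omega)
            rwa [Nat.add_right_comm p, Nat.add_right_comm q] at this
        · intro ha hb
          have := h4 (by omega) (by omega)
          rwa [Nat.add_right_comm p, Nat.add_right_comm q] at this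
      · simpa using hpq

theorem bIdx_spec {L : ℕ → ℤ} {x : ℕ} (hx : 2 ≤ x) (hL : L 1 < L x) :
    1 ≤ bIdx L x ∧ bIdx L x < x ∧ L (bIdx L x) < L x ∧
      ∀ y, bIdx L x < y → y < x → L x ≤ L y := by
  have hbdd : BddAbove {y : ℕ | (1 ≤ y ∧ y < x ∧ L y < L x) ∨ y = 1} := by
    refine ⟨x, ?_⟩
    rintro y (hy | hy) <;> omega
  have hmem : bIdx L x ∈ {y : ℕ | (1 ≤ y ∧ y < x ∧ L y < L x) ∨ y = 1} :=
    Nat.sSup_mem ⟨1, Or.inr rfl⟩ hbdd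
  have hmem' : 1 ≤ bIdx L x ∧ bIdx L x < x ∧ L (bIdx L x) < L x := by
    rcases hmem with hb | hb
    · exact hb
    · rw [hb]
      exact ⟨le_rfl, by omega, hL⟩
  refine ⟨hmem'.1, hmem'.2.1, hmem'.2.2, fun y hby hyx => ?_⟩
  by_contra! hlt
  have : y ≤ bIdx L x := le_csSup hbdd (Or.inl ⟨by omega, hyx, hlt⟩)
  omega

theorem Trev_mem {n σ : ℕ} {T : ℕ → ℤ} {dollar : ℤ} (hT : TextSetup n σ T dollar) {j : ℕ}
    (h1 : 1 ≤ j) (hn : j ≤ n) : 1 ≤ Trev T n j ∧ Trev T n j ≤ σ := by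
  have := hT.hn
  unfold Trev
  split_ifs
  · exact hT.hT n (by omega) le_rfl
  · exact hT.hT _ (by omega) (by omega)

theorem Trev_eq_last {n σ : ℕ} {T : ℕ → ℤ} {dollar : ℤ} (hT : TextSetup n σ T dollar) {j : ℕ}
    (h1 : 1 ≤ j) (hn : j ≤ n) (h : Trev T n j = Trev T n n) : j = n := by
  by_contra hne
  simp only [Trev, hne, if_false, if_true, hT.hTn] at h
  exact hT.hTne _ (by omega) (by omega) h

/-- Distinct suffixes of the reversed text branch before either of them ends. -/
theorem lcpLen_sfx_lt {n σ : ℕ} {T : ℕ → ℤ} {dollar : ℤ} (hT : TextSetup n σ T dollar) {p q : ℕ}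
    (hp : 1 ≤ p) (hpn : p ≤ n) (hq : 1 ≤ q) (hqn : q ≤ n) (hpq : p ≠ q) :
    p + lcpLen (sfx (Trev T n) n p) (sfx (Trev T n) n q) ≤ n ∧
    q + lcpLen (sfx (Trev T n) n p) (sfx (Trev T n) n q) ≤ n := by
  obtain ⟨ha, hb, heq, -⟩ := lcpLen_seg (Trev T n) p q (n + 1 - p) (n + 1 - q)
  change lcpLen (sfx (Trev T n) n p) (sfx (Trev T n) n q) ≤ _ at ha
  change lcpLen (sfx (Trev T n) n p) (sfx (Trev T n) n q) ≤ _ at hb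
  change ∀ k < lcpLen (sfx (Trev T n) n p) (sfx (Trev T n) n q), _ at heq
  generalize lcpLen (sfx (Trev T n) n p) (sfx (Trev T n) n q) = t at *
  constructor
  · by_contra! hlt
    have h := heq (n - p) (by omega)
    rw [Nat.add_sub_cancel' hpn] at h
    have := Trev_eq_last hT (by omega) (by omega) h.symm
    omega
  · by_contra! hlt
    have h := heq (n - q) (by omega)
    rw [Nat.add_sub_cancel' hqn] at h
    have := Trev_eq_last hT (by omega) (by omega) h
    omega

/-- The longest common prefix of two distinct suffixes of the reversed text is right-maximal. -/
theorem rightMax_lcp {n σ : ℕ} {T : ℕ → ℤ} {dollar : ℤ} (hT : TextSetup n σ T dollar) {p q : ℕ}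
    (hp : 1 ≤ p) (hpn : p ≤ n) (hq : 1 ≤ q) (hqn : q ≤ n) (hpq : p ≠ q) :
    RightMax (Trev T n) n σ
      (seg (Trev T n) q (lcpLen (sfx (Trev T n) n p) (sfx (Trev T n) n q))) := by
  obtain ⟨hpt, hqt⟩ := lcpLen_sfx_lt hT hp hpn hq hqn hpq
  obtain ⟨-, -, heq, hne⟩ := lcpLen_seg (Trev T n) p q (n + 1 - p) (n + 1 - q)
  change ∀ k < lcpLen (sfx (Trev T n) n p) (sfx (Trev T n) n q), _ at heq
  change lcpLen (sfx (Trev T n) n p) (sfx (Trev T n) n q) < _ →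
    lcpLen (sfx (Trev T n) n p) (sfx (Trev T n) n q) < _ →
    Trev T n (p + lcpLen (sfx (Trev T n) n p) (sfx (Trev T n) n q)) ≠
    Trev T n (q + lcpLen (sfx (Trev T n) n p) (sfx (Trev T n) n q)) at hne
  generalize lcpLen (sfx (Trev T n) n p) (sfx (Trev T n) n q) = t at *
  obtain ⟨hp1, hp2⟩ := Trev_mem hT (j := p + t) (by omega) hpt
  obtain ⟨hq1, hq2⟩ := Trev_mem hT (j := q + t) (by omega) hqt
  refine ⟨_, _, hne (by omega) (by omega), hp1, hp2, hq1, hq2, ⟨p, hp, ?_, ?_⟩, ⟨q, hq, ?_, ?_⟩⟩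
  · simp only [List.length_append, length_seg, List.length_singleton]
    omega
  · rw [← seg_congr heq, ← seg_succ_last, length_seg]
  · simp only [List.length_append, length_seg, List.length_singleton]
    omega
  · rw [← seg_succ_last, length_seg]

namespace LCPSetup

variable {n σ : ℕ} {T : ℕ → ℤ} {dollar : ℤ} {SA : ℕ → ℕ} {LCP : ℕ → ℤ}

theorem LCP_nonneg (hs : LCPSetup n σ T dollar SA LCP) {x : ℕ} (hx : 2 ≤ x) (hxn : x ≤ n) :
    0 ≤ LCP x := by
  rw [hs.hLCP x hx hxn]
  positivity

/-- The suffixes of ranks `x` and `y` agree on `t` letters if `LCP` is at least `t` on `(x, y]`. -/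
theorem seg_SA_eq (hs : LCPSetup n σ T dollar SA LCP) {x y t : ℕ} (hx : 1 ≤ x) (hxy : x ≤ y)
    (hyn : y ≤ n) (hL : ∀ z, x < z → z ≤ y → (t : ℤ) ≤ LCP z) :
    seg (Trev T n) (SA x) t = seg (Trev T n) (SA y) t := by
  induction y, hxy using Nat.le_induction with
  | base => rfl
  | succ y hxy ih =>
    rw [ih (by omega) fun z h1 h2 => hL z h1 (by omega)]
    have ht := hL (y + 1) (by omega) le_rfl
    rw [hs.hLCP (y + 1) (by omega) hyn, Nat.add_sub_cancel, Nat.cast_le] at ht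
    exact seg_congr fun k hk => (lcpLen_seg (Trev T n) _ _ _ _).2.2.1 k (hk.trans_le ht)

/-- If `LCP` is at least `LCP x` on `(x, i]`, then the prefix of length `LCP x` of the suffix of
rank `i` is right-maximal. -/
theorem rightMax_prefix (hs : LCPSetup n σ T dollar SA LCP) {x i : ℕ} (hx : 2 ≤ x) (hxi : x ≤ i)
    (hin : i ≤ n) (hL : ∀ z, x < z → z ≤ i → LCP x ≤ LCP z) :
    RightMax (Trev T n) n σ (seg (Trev T n) (SA i) (LCP x).toNat) ∧
      seg (Trev T n) (SA i) (LCP x).toNat <+: sfx (Trev T n) n (SA i) := by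
  have h0 := hs.LCP_nonneg hx (hxi.trans hin)
  have hp := hs.hSAmem (x - 1) (by omega) (by omega)
  have hq := hs.hSAmem x (by omega) (by omega)
  have hi := hs.hSAmem i (by omega) (by omega)
  have hpq : SA (x - 1) ≠ SA x := fun h => by
    have := hs.hSAinj _ _ (by omega) (by omega) (by omega) (by omega) h
    omega
  have hR := rightMax_lcp hs.toTextSetup hp.1 hp.2 hq.1 hq.2 hpq
  have ht := hs.hLCP x (by omega) (by omega)
  rw [show lcpLen (sfx (Trev T n) n (SA (x - 1))) (sfx (Trev T n) n (SA x)) = (LCP x).toNat by omega,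
    hs.seg_SA_eq (by omega) hxi hin fun z h1 h2 => by have := hL z h1 h2; omega] at hR
  refine ⟨hR, seg_prefix_seg _ _ ?_⟩
  rcases hxi.eq_or_lt with rfl | hlt
  · have := (lcpLen_sfx_lt hs.toTextSetup hp.1 hp.2 hq.1 hq.2 hpq).2
    omega
  · have hp' := hs.hSAmem (i - 1) (by omega) (by omega)
    have hpq' : SA (i - 1) ≠ SA i := fun h => by
      have := hs.hSAinj _ _ (by omega) (by omega) (by omega) (by omega) h
      omega
    have := (lcpLen_sfx_lt hs.toTextSetup hp'.1 hp'.2 hi.1 hi.2 hpq').2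
    have hti := hs.hLCP i (by omega) (by omega)
    have := hL i hlt le_rfl
    omega

end LCPSetup

/-- For `2 ≤ i ≤ n`, the chain `i = x_0 > x_1 > … > x_m = 1` with
`x_{k+1} = b(x_k)`, terminating at the first index equal to `1`, has at most `h + 1` indices,
where `h` is the maximum over all suffixes `S` of `T^rev` of the number of distinct
right-maximal substrings of `T^rev` occurring as prefixes of `S`. -/
theorem stmt17 (n σ : ℕ) (T : ℕ → ℤ) (dollar : ℤ) (SA : ℕ → ℕ) (LCP : ℕ → ℤ)
    (hsetup : LCPSetup n σ T dollar SA LCP)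
    (i : ℕ) (hi2 : 2 ≤ i) (hin : i ≤ n)
    (m : ℕ) (chain : ℕ → ℕ)
    (hc0 : chain 0 = i)
    (hstep : ∀ k, k < m → chain (k + 1) = bIdx LCP (chain k))
    (hne1 : ∀ k, k < m → chain k ≠ 1)
    (hend : chain m = 1)
    (h : ℕ)
    (hh : IsGreatest {t : ℕ | ∃ p, 1 ≤ p ∧ p ≤ n ∧
      t = Set.ncard {s : List ℤ | RightMax (Trev T n) n σ s ∧ s <+: sfx (Trev T n) n p}} h) :
    m ≤ h := by
  have hb : ∀ k, k < m → 2 ≤ chain k → chain k ≤ i →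
      1 ≤ chain (k + 1) ∧ chain (k + 1) < chain k ∧ LCP (chain (k + 1)) < LCP (chain k) ∧
        ∀ y, chain (k + 1) < y → y < chain k → LCP (chain k) ≤ LCP y := by
    intro k hk h2 hki
    rw [hstep k hk]
    refine bIdx_spec h2 ?_
    have := hsetup.LCP_nonneg h2 (hki.trans hin)
    rw [hsetup.hLCP1]
    omega
  have hinv : ∀ k, k < m → 2 ≤ chain k ∧ chain k ≤ i ∧
      ∀ y, chain k < y → y ≤ i → LCP (chain k) < LCP y := by
    intro k
    induction k with
    | zero =>
      intro _
      rw [hc0]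
      exact ⟨hi2, le_rfl, fun y _ _ => by omega⟩
    | succ k ih =>
      intro hk
      obtain ⟨h2, hki, hL⟩ := ih (by omega)
      obtain ⟨g1, g2, g3, g4⟩ := hb k (by omega) h2 hki
      have := hne1 (k + 1) hk
      refine ⟨by omega, by omega, fun y hy hyi => ?_⟩
      rcases lt_trichotomy y (chain k) with hlt | rfl | hgt
      · exact g3.trans_le (g4 y hy hlt)
      · exact g3
      · exact g3.trans (hL y hgt hyi)
  have hanti : ∀ j k, j < k → k < m → LCP (chain k) < LCP (chain j) := by
    intro j k hjk hkm
    induction k, hjk using Nat.le_induction with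
    | base => exact (hb j (by omega) (hinv j (by omega)).1 (hinv j (by omega)).2.1).2.2.1
    | succ k _ ih =>
      exact (hb k (by omega) (hinv k (by omega)).1 (hinv k (by omega)).2.1).2.2.1.trans
        (ih (by omega))
  have hnonneg : ∀ k, k < m → 0 ≤ LCP (chain k) := fun k hk =>
    hsetup.LCP_nonneg (hinv k hk).1 ((hinv k hk).2.1.trans hin)
  have hp := hsetup.hSAmem i (by omega) hin
  refine le_trans ?_ (hh.2 ⟨SA i, hp.1, hp.2, rfl⟩)
  set f : ℕ → List ℤ := fun k => seg (Trev T n) (SA i) (LCP (chain k)).toNat with hf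
  have hinj : Set.InjOn f (Finset.range m) := by
    intro j hj k hk hjk
    simp only [Finset.coe_range, Set.mem_Iio] at hj hk
    have hlen := congrArg List.length hjk
    simp only [hf, length_seg] at hlen
    have := hnonneg j hj
    have := hnonneg k hk
    rcases lt_trichotomy j k with hlt | heq | hgt
    · have := hanti j k hlt hk
      omega
    · exact heq
    · have := hanti k j hgt hj
      omega
  calc m = ((Finset.range m).image f).card := by
        rw [Finset.card_image_of_injOn hinj, Finset.card_range]
    _ = Set.ncard (((Finset.range m).image f : Finset (List ℤ)) : Set (List ℤ)) :=
        (Set.ncard_coe_finset _).symm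
    _ ≤ _ := by
      refine Set.ncard_le_ncard ?_ ?_
      · intro s hs
        obtain ⟨k, hk, rfl⟩ := Finset.mem_image.1 (Finset.mem_coe.1 hs)
        obtain ⟨h2, hki, hL⟩ := hinv k (Finset.mem_range.1 hk)
        exact hsetup.rightMax_prefix h2 hki hin fun z h1 h2 => (hL z h1 h2).le
      · refine (List.finite_toSet (sfx (Trev T n) n (SA i)).inits).subset fun s hs => ?_
        exact (List.mem_inits _ _).2 hs.2
end
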